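/- arXiv:1801.08664 — 2 statements merged into one kernel-verified Lean document; each statement's English description precedes it below -/
import Mathlib

section
/- For every τ with 0 ≤ τ < N, the cross-correlation of v and u′ satisfies: R_{v,u′}(τ) = 3 if τ ∈ D_3, and R_{v,u′}(τ) = −1 otherwise. -/
open Finset Polynomial

def corr (n : ℕ) (a b : ℤ → ℕ) (τ : ℤ) : ℤ :=
  ∑ i ∈ Finset.range n, (-1 : ℤ) ^ (a i + b ((i : ℤ) + τ))

def Dclass (N f : ℕ) (β : ZMod N) (j : ℕ) : Set (ZMod N) :=
  {x | ∃ k < f, x = β ^ (4 * k + j)}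

open Classical in
/-- The binary sequence of period `N` whose characteristic set is `S ⊆ Z_N`. -/
noncomputable def chiSeq (N : ℕ) (S : Set (ZMod N)) : ℤ → ℕ :=
  fun t => if (t : ZMod N) ∈ S then 1 else 0

/-- A Gaussian integer of norm one is a power of `i`. -/
lemma gaussianInt_cases_of_norm_eq_one {z : GaussianInt} (hz : z.norm = 1) :
    z = ⟨1, 0⟩ ∨ z = ⟨0, 1⟩ ∨ z = ⟨-1, 0⟩ ∨ z = ⟨0, -1⟩ := by
  obtain ⟨r, m⟩ := z
  have h : r * r + m * m = 1 := by simpa [Zsqrtd.norm_def] using hz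
  have hr1 : r ≤ 1 := by nlinarith
  have hr2 : -1 ≤ r := by nlinarith
  have hm1 : m ≤ 1 := by nlinarith
  have hm2 : -1 ≤ m := by nlinarith
  interval_cases r <;> interval_cases m <;> simp_all

lemma MulChar.inv_apply_eq_star_gaussianInt {F : Type*} [Field F] [Finite F]
    (χ : MulChar F GaussianInt) (a : F) : χ⁻¹ a = star (χ a) := by
  apply GaussianInt.toComplex_injective
  have h := MulChar.star_apply' (χ.ringHomComp GaussianInt.toComplex) a
  rw [MulChar.inv_apply'] at h ⊢
  simpa [MulChar.ringHomComp_apply, GaussianInt.toComplex_star] using h.symm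

lemma MulChar.norm_apply_gaussianInt {F : Type*} [Field F] [Finite F]
    (χ : MulChar F GaussianInt) {a : F} (ha : a ≠ 0) : (χ a).norm = 1 := by
  have h : ((χ a).norm : GaussianInt) = 1 := by
    rw [Zsqrtd.norm_eq_mul_conj, ← MulChar.inv_apply_eq_star_gaussianInt, MulChar.inv_apply',
      ← map_mul, mul_inv_cancel₀ ha, map_one]
  exact_mod_cast h

/-- The shifted correlation of two multiplicative characters is a multiple of a Jacobi sum. -/
lemma sum_mulChar_mul_mulChar_add {F R : Type*} [Field F] [Fintype F] [CommRing R]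
    (χ φ : MulChar F R) {t : F} (ht : t ≠ 0) :
    ∑ x, χ x * φ (x + t) = χ (-t) * φ t * jacobiSum χ φ := by
  rw [jacobiSum, Finset.mul_sum,
    ← Equiv.sum_comp (Equiv.mulLeft₀ (-t) (neg_ne_zero.mpr ht)) fun x => χ x * φ (x + t)]
  refine Finset.sum_congr rfl fun w _ => ?_
  rw [Equiv.mulLeft₀_apply, show -t * w + t = t * (1 - w) by ring, map_mul, map_mul]
  ring

lemma norm_jacobiSum_gaussianInt {F : Type*} [Field F] [Fintype F] {χ φ : MulChar F GaussianInt}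
    (hχ : χ ≠ 1) (hφ : φ ≠ 1) (hχφ : χ * φ ≠ 1) :
    (jacobiSum χ φ).norm = Fintype.card F := by
  have hinj : Function.Injective GaussianInt.toComplex := GaussianInt.toComplex_injective
  have hne : ∀ {ψ : MulChar F GaussianInt}, ψ ≠ 1 → ψ.ringHomComp GaussianInt.toComplex ≠ 1 :=
    fun h => (MulChar.ringHomComp_ne_one_iff hinj).mpr h
  have hchar : ringChar ℂ ≠ ringChar F := by
    rw [ringChar.eq_zero]
    exact (CharP.ringChar_ne_zero_of_finite F).symm
  have h := jacobiSum_mul_jacobiSum_inv hchar (hne hχ) (hne hφ)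
    (by rw [← MulChar.ringHomComp_mul]; exact hne hχφ)
  rw [MulChar.ringHomComp_inv, MulChar.ringHomComp_inv, jacobiSum_ringHomComp,
    jacobiSum_ringHomComp, ← map_mul] at h
  have hstar : jacobiSum χ⁻¹ φ⁻¹ = star (jacobiSum χ φ) := by
    simp [jacobiSum, MulChar.inv_apply_eq_star_gaussianInt]
  have h' : ((jacobiSum χ φ).norm : GaussianInt) = ((Fintype.card F : ℤ) : GaussianInt) := by
    apply hinj
    rw [Zsqrtd.norm_eq_mul_conj, ← hstar, h]
    simp
  exact_mod_cast h'

/-- A finset stable under a fixed-point-free involution has even cardinality. -/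
lemma Finset.even_card_of_involution {α : Type*} (s : Finset α) (g : α → α)
    (hmem : ∀ x ∈ s, g x ∈ s) (hinv : ∀ x, g (g x) = x) (hfix : ∀ x ∈ s, g x ≠ x) :
    Even s.card := by
  rw [← ZMod.natCast_eq_zero_iff_even, Finset.cast_card]
  exact Finset.sum_involution (fun x _ => g x) (fun _ _ => by decide)
    (fun x hx _ => hfix x hx) (fun x hx => hmem x hx) (fun x _ => hinv x)

lemma re_jacobiSum_self_emod_four {F : Type*} [Field F] [Fintype F]
    (χ : MulChar F GaussianInt) (h2 : χ 2 ^ 2 = -1) {f : ℕ} (hf : Odd f)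
    (hF : Fintype.card F = 4 * f + 1) : (jacobiSum χ χ).re % 4 = 3 := by
  classical
  have h20 : (2 : F) ≠ 0 := by
    intro h
    rw [h, MulChar.map_zero] at h2
    exact absurd h2 (by decide)
  have hsq : χ ^ 2 ≠ 1 := by
    intro h
    have h' : (χ ^ 2) 2 = 1 := by rw [h, MulChar.one_apply (IsUnit.mk0 _ h20)]
    rw [MulChar.pow_apply' _ two_ne_zero, h2] at h'
    exact absurd h' (by decide)
  have hinv : (χ ^ 2)⁻¹ = χ ^ 2 := by
    refine MulChar.ext fun a => ?_
    rw [MulChar.inv_apply_eq_star_gaussianInt, MulChar.pow_apply' _ two_ne_zero]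
    rcases gaussianInt_cases_of_norm_eq_one (χ.norm_apply_gaussianInt a.ne_zero)
      with h | h | h | h <;> rw [h] <;> decide
  have hJ : jacobiSum (χ ^ 2) (χ ^ 2) = -1 := by
    have h := jacobiSum_nontrivial_inv hsq
    rw [hinv] at h
    rw [h, MulChar.pow_apply' _ two_ne_zero, ← map_pow, neg_one_sq, map_one]
  have hterm : ∀ x : F, 2 * (χ x * χ (1 - x)).re + ((χ ^ 2) x * (χ ^ 2) (1 - x)).re
      + ((1 : MulChar F GaussianInt) x * (1 : MulChar F GaussianInt) (1 - x)).re
      = 4 * if χ x * χ (1 - x) = 1 then 1 else 0 := by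
    intro x
    rcases eq_or_ne x 0 with rfl | h0
    · simp [MulChar.map_zero]
    rcases eq_or_ne x 1 with rfl | h1
    · simp [MulChar.map_zero]
    have h1' : 1 - x ≠ 0 := sub_ne_zero.mpr h1.symm
    rw [MulChar.one_apply (IsUnit.mk0 _ h0), MulChar.one_apply (IsUnit.mk0 _ h1'),
      MulChar.pow_apply' _ two_ne_zero, MulChar.pow_apply' _ two_ne_zero, ← mul_pow, ← map_mul]
    rcases gaussianInt_cases_of_norm_eq_one (χ.norm_apply_gaussianInt (mul_ne_zero h0 h1'))
      with h | h | h | h <;> rw [h] <;> decide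
  have hre : ∀ g : F → GaussianInt, (∑ x, g x).re = ∑ x, (g x).re := fun g =>
    map_sum (AddMonoidHom.mk' (Zsqrtd.re : GaussianInt → ℤ) Zsqrtd.re_add) g _
  have hsum := Finset.sum_congr (rfl : (Finset.univ : Finset F) = _) fun x _ => hterm x
  rw [Finset.sum_add_distrib, Finset.sum_add_distrib, ← Finset.mul_sum, ← hre, ← hre, ← hre,
    ← Finset.mul_sum, Finset.sum_boole] at hsum
  have h11 := jacobiSum_one_one (F := F) (R := GaussianInt)
  rw [jacobiSum] at h11 hJ
  rw [h11, hJ, hF] at hsum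
  have hcard : ((4 * f + 1 : ℕ) - 2 : GaussianInt).re = 4 * f - 1 := by
    rw [Zsqrtd.re_sub, Zsqrtd.re_natCast]
    push_cast
    change (4 * f + 1 : ℤ) - 2 = _
    ring
  rw [hcard] at hsum
  have heven := Finset.even_card_of_involution {x : F | χ x * χ (1 - x) = 1} (fun x => 1 - x)
    (by simp [mul_comm]) (by simp) (by
      intro x hx hfix
      rw [Finset.mem_filter_univ, hfix] at hx
      have h2x : χ 2 * χ x = 1 := by
        rw [← map_mul, two_mul]
        nth_rewrite 1 [← hfix]
        rw [sub_add_cancel, map_one]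
      have : (χ 2 * χ x) ^ 2 = -1 := by rw [mul_pow, h2, sq, hx, mul_one]
      rw [h2x] at this
      exact absurd this (by decide))
  obtain ⟨m, hm⟩ := heven
  obtain ⟨l, hl⟩ := hf
  rw [hm, hl] at hsum
  have hneg : (-1 : GaussianInt).re = -1 := rfl
  rw [hneg] at hsum
  push_cast at hsum
  rw [jacobiSum]
  omega

/-- The representation of a prime as `a ^ 2 + b ^ 2` with `a` odd determines `a` up to sign;
here one representation is `1 + 4 y ^ 2`. -/
lemma sq_eq_one_of_sq_add_sq_eq_prime {p : ℕ} (hp : p.Prime) {a b y : ℤ} (ha : Odd a)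
    (h : a ^ 2 + b ^ 2 = p) (hy : 1 + 4 * y ^ 2 = p) : a ^ 2 = 1 := by
  have hp' : Prime (p : ℤ) := Nat.prime_iff_prime_int.mp hp
  have hp0 : (0 : ℤ) < p := by exact_mod_cast hp.pos
  have key : ∀ c : ℤ, a ^ 2 + c ^ 2 = p → (p : ℤ) ∣ 2 * y * a - c → a ^ 2 = 1 := by
    rintro c hc ⟨k, hk⟩
    have hid : (2 * y * a - c) ^ 2 + (a + 2 * y * c) ^ 2 = (p : ℤ) ^ 2 := by
      rw [sq (p : ℤ)]
      nth_rewrite 1 [← hc]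
      rw [← hy]
      ring
    have hk1 : k ^ 2 ≤ 1 := by
      by_contra! hlt
      rw [hk] at hid
      nlinarith [sq_nonneg (a + 2 * y * c), mul_pos hp0 hp0]
    rcases eq_or_ne k 0 with rfl | hk0
    · have hc' : c = 2 * y * a := by linarith
      rw [hc', ← hy] at hc
      have : (a ^ 2 - 1) * (1 + 4 * y ^ 2) = 0 := by linear_combination hc
      rcases mul_eq_zero.mp this with h | h <;> nlinarith
    · exfalso
      have hk2 : k ^ 2 = 1 := by
        have := sq_pos_of_ne_zero hk0
        omega
      rw [hk, mul_pow, hk2] at hid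
      have h0 : a + 2 * y * c = 0 := pow_eq_zero_iff two_ne_zero |>.mp (by linarith)
      obtain ⟨l, hl⟩ := ha
      have : 2 * (l + y * c) + 1 = 0 := by rw [hl] at h0; linarith
      omega
  have hdvd : (p : ℤ) ∣ (2 * y * a - b) * (2 * y * a - -b) :=
    ⟨a ^ 2 - 1, by linear_combination a ^ 2 * hy - h⟩
  rcases hp'.dvd_or_dvd hdvd with hd | hd
  · exact key b h hd
  · exact key (-b) (by rw [neg_sq]; exact h) hd

lemma sum_range_intCast_zmod {M : Type*} [AddCommMonoid M] (N : ℕ) [NeZero N] (g : ZMod N → M) :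
    ∑ i ∈ Finset.range N, g ((i : ℤ) : ZMod N) = ∑ x, g x := by
  refine Finset.sum_nbij' (fun i => ((i : ℤ) : ZMod N)) ZMod.val (by simp)
    (fun x _ => Finset.mem_range.mpr (ZMod.val_lt x)) ?_ (by simp) (by simp)
  intro i hi
  rw [Int.cast_natCast, ZMod.val_cast_of_lt (Finset.mem_range.mp hi)]

/-- There is a quartic character with values in `ℤ[i]` sending a given generator to `i`. -/
lemma exists_quartic_mulChar {N f : ℕ} [Fact N.Prime] (hNf : N = 4 * f + 1) {β : ZMod N}
    (hβ : orderOf β = N - 1) :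
    ∃ χ : MulChar (ZMod N) GaussianInt, χ β = ⟨0, 1⟩ ∧
      ∀ x : ZMod N, x ≠ 0 → ∃ k < 4 * f, x = β ^ k := by
  have hN1 := (Fact.out : N.Prime).one_lt
  have hβ0 : β ≠ 0 := by
    rintro rfl
    rw [orderOf_zero] at hβ
    omega
  have hord : orderOf (Units.mk0 β hβ0) = Nat.card (ZMod N)ˣ := by
    rw [← orderOf_units, Units.val_mk0, hβ, Nat.card_eq_fintype_card, ZMod.card_units]
  have hgen : ∀ x, x ∈ Subgroup.zpowers (Units.mk0 β hβ0) := fun x => by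
    rw [Subgroup.eq_top_of_card_eq (Subgroup.zpowers (Units.mk0 β hβ0))
      (by rw [Nat.card_zpowers, hord])]
    trivial
  obtain ⟨ζ, hζI⟩ : ∃ ζ : GaussianIntˣ, (ζ : GaussianInt) = ⟨0, 1⟩ :=
    ⟨⟨⟨0, 1⟩, ⟨0, -1⟩, by decide, by decide⟩, rfl⟩
  have hζ : ζ ∈ rootsOfUnity (Fintype.card (ZMod N)ˣ) GaussianInt := by
    rw [mem_rootsOfUnity, ZMod.card_units, hNf, Nat.add_sub_cancel, pow_mul,
      show ζ ^ 4 = 1 from Units.ext (by rw [Units.val_pow_eq_pow_val, hζI]; decide), one_pow]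
  have hspec := MulChar.ofRootOfUnity_spec hζ hgen
  rw [Units.val_mk0, hζI] at hspec
  refine ⟨MulChar.ofRootOfUnity hζ hgen, hspec, fun x hx => ?_⟩
  obtain ⟨k, hk⟩ := mem_powers_iff_mem_zpowers.mpr (hgen (Units.mk0 x hx))
  refine ⟨k % (4 * f), Nat.mod_lt _ (by omega), ?_⟩
  have hk' : β ^ k = x := by simpa using congrArg Units.val hk
  rw [← hk', ← pow_mod_orderOf, hβ, show N - 1 = 4 * f by omega]

lemma mem_Dclass_iff {N f : ℕ} [Fact N.Prime] {β : ZMod N} {χ : MulChar (ZMod N) GaussianInt}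
    (hχ : χ β = ⟨0, 1⟩) (hβ : ∀ x : ZMod N, x ≠ 0 → ∃ k < 4 * f, x = β ^ k) {j : ℕ} (hj : j < 4)
    (x : ZMod N) : x ∈ Dclass N f β j ↔ χ x = (⟨0, 1⟩ : GaussianInt) ^ j := by
  have hI : (⟨0, 1⟩ : GaussianInt) ^ 4 = 1 := by decide
  constructor
  · rintro ⟨k, -, rfl⟩
    rw [map_pow, hχ, pow_add, pow_mul, hI, one_pow, one_mul]
  · intro hx
    have hx0 : x ≠ 0 := by
      rintro rfl
      rw [MulChar.map_zero] at hx
      interval_cases j <;> exact absurd hx (by decide)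
    obtain ⟨k, hk, rfl⟩ := hβ x hx0
    rw [map_pow, hχ, pow_eq_pow_mod k hI] at hx
    have hkj : k % 4 = j := by
      have hlt : k % 4 < 4 := Nat.mod_lt _ (by norm_num)
      generalize k % 4 = r at hx hlt
      interval_cases r <;> interval_cases j <;> first | rfl | exact absurd hx (by decide)
    exact ⟨k / 4, by omega, by congr 1; omega⟩

/-- A sum over the quartic character with values in `ℤ[i]` in terms of the Jacobi sum. -/
lemma sum_quartic_correlation {F : Type*} [Field F] [Fintype F] {χ : MulChar F GaussianInt}
    (hχ : χ ≠ 1) (hχ1 : χ (-1) = -1) {t : F} (ht : t ≠ 0) :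
    ∑ x, ((χ x).re - (χ x).im) * -((χ (x + t)).re + (χ (x + t)).im)
      = (χ t ^ 2 * jacobiSum χ χ).re := by
  have hneg : χ (-t) = -χ t := by
    rw [neg_eq_neg_one_mul t, map_mul, hχ1, neg_one_mul]
  have hre : ∀ g : F → GaussianInt, (∑ x, g x).re = ∑ x, (g x).re := fun g =>
    map_sum (AddMonoidHom.mk' (Zsqrtd.re : GaussianInt → ℤ) Zsqrtd.re_add) g _
  have him : ∀ g : F → GaussianInt, (∑ x, g x).im = ∑ x, (g x).im := fun g =>
    map_sum (AddMonoidHom.mk' (Zsqrtd.im : GaussianInt → ℤ) Zsqrtd.im_add) g _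
  have h1 := congrArg Zsqrtd.re (sum_mulChar_mul_mulChar_add χ χ ht)
  have h2 := congrArg Zsqrtd.im (sum_mulChar_mul_mulChar_add χ χ⁻¹ ht)
  have hone : χ t * χ⁻¹ t = 1 := by
    rw [MulChar.inv_apply', ← map_mul, mul_inv_cancel₀ ht, map_one]
  rw [hre, hneg, show -χ t * χ t * jacobiSum χ χ = -(χ t ^ 2 * jacobiSum χ χ) by ring,
    Zsqrtd.re_neg] at h1
  rw [him, jacobiSum_nontrivial_inv hχ, hχ1, neg_neg, mul_one, hneg, neg_mul, hone] at h2
  have h3 : ∑ x, ((χ x).re - (χ x).im) * -((χ (x + t)).re + (χ (x + t)).im)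
      = -∑ x, (χ x * χ (x + t)).re + ∑ x, (χ x * χ⁻¹ (x + t)).im := by
    rw [← Finset.sum_neg_distrib, ← Finset.sum_add_distrib]
    refine Finset.sum_congr rfl fun x _ => ?_
    rw [MulChar.inv_apply_eq_star_gaussianInt, Zsqrtd.re_mul, Zsqrtd.im_mul, Zsqrtd.re_star,
      Zsqrtd.im_star]
    ring
  rw [h3, h1, h2, neg_neg]
  exact add_zero _

lemma sum_quartic_correlation_zero {F : Type*} [Field F] [Fintype F] {χ : MulChar F GaussianInt}
    (hχ : χ ^ 2 ≠ 1) :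
    ∑ x, ((χ x).re - (χ x).im) * -((χ x).re + (χ x).im) = 0 := by
  have hre : ∀ g : F → GaussianInt, (∑ x, g x).re = ∑ x, (g x).re := fun g =>
    map_sum (AddMonoidHom.mk' (Zsqrtd.re : GaussianInt → ℤ) Zsqrtd.re_add) g _
  have h := congrArg Zsqrtd.re (MulChar.sum_eq_zero_of_ne_one hχ)
  rw [hre, Zsqrtd.re_zero] at h
  rw [← neg_eq_zero, ← Finset.sum_neg_distrib, ← h]
  refine Finset.sum_congr rfl fun x _ => ?_
  rw [MulChar.pow_apply' _ two_ne_zero, sq, Zsqrtd.re_mul]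
  ring

/-- Adjusting the two factors of a correlation at the origin. -/
lemma sum_add_ite_mul_sub_ite {F : Type*} [AddCommGroup F] [Fintype F] [DecidableEq F]
    (a b : F → ℤ) (t : F) :
    ∑ x, (a x + if x = 0 then 1 else 0) * (b (x + t) - if x + t = 0 then 1 else 0)
      = ∑ x, a x * b (x + t) + b t - a (-t) - if t = 0 then 1 else 0 := by
  simp only [mul_sub, add_mul, Finset.sum_add_distrib, Finset.sum_sub_distrib,
    add_eq_zero_iff_eq_neg, mul_ite, ite_mul, mul_one, mul_zero, one_mul, zero_mul,
    Finset.sum_ite_eq', Finset.mem_univ, if_true, zero_add]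
  rcases eq_or_ne t 0 with rfl | ht
  · simp
    ring
  · simp [ht]

/-- the cross-correlation `R_{v,u'}`. -/
theorem stmt5 (N f y : ℕ) (hprime : N.Prime) (hNf : N = 4 * f + 1) (hN5 : 5 ≤ N)
    (hfy : f = y ^ 2) (hy : 0 < y) (hfodd : Odd f)
    (β : ZMod N) (hβ : orderOf β = N - 1)
    (u' v : ℤ → ℕ)
    (hu' : u' = chiSeq N ({0} ∪ Dclass N f β 0 ∪ Dclass N f β 1))
    (hv : v = chiSeq N (Dclass N f β 1 ∪ Dclass N f β 2)) :
    ∀ τ : ℤ, 0 ≤ τ → τ < N →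
      ((τ : ZMod N) ∈ Dclass N f β 3 → corr N v u' τ = 3) ∧
      ((τ : ZMod N) ∉ Dclass N f β 3 → corr N v u' τ = -1) := by
  have : Fact N.Prime := ⟨hprime⟩
  obtain ⟨χ, hχ, hgen⟩ := exists_quartic_mulChar hNf hβ
  have hmem := fun {j : ℕ} (hj : j < 4) => mem_Dclass_iff hχ hgen hj
  have hβ0 : β ≠ 0 := by
    rintro rfl
    rw [MulChar.map_zero] at hχ
    exact absurd hχ (by decide)
  have hχne : χ ≠ 1 := by
    rintro rfl
    rw [MulChar.one_apply (IsUnit.mk0 _ hβ0)] at hχ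
    exact absurd hχ (by decide)
  have hχ2 : χ ^ 2 ≠ 1 := by
    intro h
    have h' : (χ ^ 2) β = 1 := by rw [h, MulChar.one_apply (IsUnit.mk0 _ hβ0)]
    rw [MulChar.pow_apply' _ two_ne_zero, hχ] at h'
    exact absurd h' (by decide)
  have hχneg : χ (-1) = -1 := by
    have hsq : (β ^ (2 * f)) ^ 2 = 1 := by
      rw [← pow_mul, show 2 * f * 2 = orderOf β by omega, pow_orderOf_eq_one]
    have hne : β ^ (2 * f) ≠ 1 := by
      apply pow_ne_one_of_lt_orderOf <;> omega
    rw [← (sq_eq_one_iff.mp hsq).resolve_left hne, map_pow, hχ, pow_mul]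
    exact hfodd.neg_one_pow
  have hχtwo : χ 2 ^ 2 = -1 := by
    have h20 : (2 : ZMod N) ≠ 0 := by
      intro h
      have h' := (ZMod.natCast_eq_zero_iff 2 N).mp (by exact_mod_cast h)
      exact absurd (Nat.le_of_dvd two_pos h') (by omega)
    obtain ⟨k, -, hk⟩ := hgen 2 h20
    have hkodd : Odd k := by
      by_contra hev
      obtain ⟨m, rfl⟩ := Nat.not_odd_iff_even.mp hev
      have hsq : IsSquare (2 : ZMod N) := ⟨β ^ m, by rw [hk, pow_add]⟩
      rw [ZMod.exists_sq_eq_two_iff (by omega)] at hsq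
      obtain ⟨l, hl⟩ := hfodd
      omega
    rw [hk, map_pow, hχ, ← pow_mul, mul_comm, pow_mul]
    exact hkodd.neg_one_pow
  have hmod := re_jacobiSum_self_emod_four χ hχtwo hfodd ((ZMod.card N).trans hNf)
  have hJre : (jacobiSum χ χ).re = -1 := by
    have hnorm := norm_jacobiSum_gaussianInt hχne hχne (by rwa [← sq])
    rw [Zsqrtd.norm_def, ZMod.card] at hnorm
    have h := sq_eq_one_of_sq_add_sq_eq_prime (a := (jacobiSum χ χ).re)
      (b := (jacobiSum χ χ).im) (y := y) hprime (Int.odd_iff.mpr (by omega))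
      (by rw [← hnorm]; ring) (by rw [hNf, hfy]; push_cast; ring)
    rcases sq_eq_one_iff.mp h with h | h <;> omega
  have hv' : ∀ s : ℤ, (-1 : ℤ) ^ v s
      = (χ s).re - (χ s).im + if (s : ZMod N) = 0 then 1 else 0 := by
    intro s
    simp only [hv, chiSeq, Set.mem_union, hmem (show 1 < 4 by norm_num),
      hmem (show 2 < 4 by norm_num)]
    generalize (s : ZMod N) = x
    rcases eq_or_ne x 0 with rfl | hx
    · rw [MulChar.map_zero]
      simp only [if_true]
      decide
    · simp only [hx, if_false]
      rcases gaussianInt_cases_of_norm_eq_one (χ.norm_apply_gaussianInt hx)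
        with h | h | h | h <;> rw [h] <;> decide
  have hu'' : ∀ s : ℤ, (-1 : ℤ) ^ u' s
      = -((χ s).re + (χ s).im) - if (s : ZMod N) = 0 then 1 else 0 := by
    intro s
    simp only [hu', chiSeq, Set.mem_union, Set.mem_singleton_iff, hmem (show 0 < 4 by norm_num),
      hmem (show 1 < 4 by norm_num)]
    generalize (s : ZMod N) = x
    rcases eq_or_ne x 0 with rfl | hx
    · rw [MulChar.map_zero]
      simp
    · simp only [hx, if_false, false_or]
      rcases gaussianInt_cases_of_norm_eq_one (χ.norm_apply_gaussianInt hx)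
        with h | h | h | h <;> rw [h] <;> decide
  intro τ _ _
  have hcorr : corr N v u' τ = ∑ x, ((χ x).re - (χ x).im) * -((χ (x + τ)).re + (χ (x + τ)).im)
      + -((χ τ).re + (χ τ).im) - ((χ (-τ)).re - (χ (-τ)).im)
      - if (τ : ZMod N) = 0 then 1 else 0 := by
    rw [corr]
    simp only [pow_add, hv', hu'', Int.cast_add]
    rw [sum_range_intCast_zmod N fun x => ((χ x).re - (χ x).im + if x = 0 then 1 else 0) *
      (-((χ (x + τ)).re + (χ (x + τ)).im) - if x + τ = 0 then 1 else 0)]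
    exact sum_add_ite_mul_sub_ite (fun x => (χ x).re - (χ x).im)
      (fun x => -((χ x).re + (χ x).im)) (τ : ZMod N)
  rw [hcorr, hmem (show 3 < 4 by norm_num)]
  generalize (τ : ZMod N) = t
  rcases eq_or_ne t 0 with rfl | ht
  · simp only [add_zero, sum_quartic_correlation_zero hχ2, neg_zero, MulChar.map_zero, if_true]
    decide
  · rw [sum_quartic_correlation hχne hχneg ht, neg_eq_neg_one_mul t, map_mul, hχneg, neg_one_mul,
      if_neg ht]
    rcases gaussianInt_cases_of_norm_eq_one (χ.norm_apply_gaussianInt ht)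
      with h | h | h | h <;> simp [h, pow_succ, Zsqrtd.ext_iff, hJre]
end

section
/- Suppose 2 mod N ∉ D_0. Then gcd(S_v(x), x^N − 1) = x − 1 in F_2[x]; equivalently, the minimal polynomial of v is (x^N − 1)/(x − 1) and the linear complexity of v is N − 1. -/
open Finset Polynomial

/-- The sequence polynomial over F_2 of a sequence of period `n`. -/
noncomputable def Spoly (n : ℕ) (s : ℤ → ℕ) : Polynomial (ZMod 2) :=
  ∑ i ∈ Finset.range n, Polynomial.C ((s (i : ℤ) : ZMod 2)) * Polynomial.X ^ i

theorem isPrimitiveRoot_of_orderOf {N : ℕ} {β : ZMod N} (hβ : orderOf β = N - 1) :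
    IsPrimitiveRoot β (N - 1) :=
  hβ ▸ IsPrimitiveRoot.orderOf β

/-- A primitive root modulo a prime generates all nonzero residues. -/
theorem exists_pow_eq_of_ne_zero {N : ℕ} [Fact N.Prime] {β : ZMod N} (hβ : orderOf β = N - 1)
    {x : ZMod N} (hx : x ≠ 0) : ∃ n, β ^ n = x := by
  have : NeZero (N - 1) := ⟨(Nat.sub_pos_of_lt (Fact.out : N.Prime).one_lt).ne'⟩
  obtain ⟨n, -, hn⟩ := (isPrimitiveRoot_of_orderOf hβ).eq_pow_of_pow_eq_one
    (ZMod.pow_card_sub_one_eq_one hx)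
  exact ⟨n, hn⟩

theorem pow_mem_Dclass_iff {N f : ℕ} (hNf : N = 4 * f + 1) (hf : 0 < f) {β : ZMod N}
    (hβ : orderOf β = N - 1) {j : ℕ} (hj : j < 4) (n : ℕ) :
    β ^ n ∈ Dclass N f β j ↔ n % 4 = j := by
  have hβ' : orderOf β = 4 * f := by omega
  constructor
  · rintro ⟨k, -, hk⟩
    have h : n ≡ 4 * k + j [MOD 4 * f] := by
      rw [← pow_mod_orderOf, ← pow_mod_orderOf β (4 * k + j), hβ'] at hk
      have hprim : IsPrimitiveRoot β (4 * f) := hβ' ▸ IsPrimitiveRoot.orderOf β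
      exact hprim.pow_inj (Nat.mod_lt _ (by omega)) (Nat.mod_lt _ (by omega)) hk
    have h4 : n % 4 = (4 * k + j) % 4 := h.of_mul_right f
    omega
  · intro h
    have hlt : n % (4 * f) < 4 * f := Nat.mod_lt _ (by omega)
    have hmod : n % (4 * f) % 4 = n % 4 := Nat.mod_mul_right_mod n 4 f
    refine ⟨n % (4 * f) / 4, by omega, ?_⟩
    have hn : 4 * (n % (4 * f) / 4) + j = n % (4 * f) := by omega
    rw [hn, ← hβ', pow_mod_orderOf]

theorem ne_zero_of_mem_Dclass {N f : ℕ} [Fact N.Prime] {β x : ZMod N} (h0 : β ≠ 0) {j : ℕ}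
    (hx : x ∈ Dclass N f β j) : x ≠ 0 := by
  obtain ⟨k, -, rfl⟩ := hx
  exact pow_ne_zero _ h0

open Classical in
/-- The value of a sequence polynomial as a sum over residues. -/
theorem aeval_Spoly_chiSeq {R : Type*} [CommRing R] [Algebra (ZMod 2) R] (N : ℕ) [NeZero N]
    (S : Set (ZMod N)) (θ : R) :
    aeval θ (Spoly N (chiSeq N S)) = ∑ t : ZMod N, (if t ∈ S then 1 else 0) * θ ^ t.val := by
  simp only [Spoly, chiSeq, map_sum, map_mul, aeval_C, map_pow, aeval_X, Nat.cast_ite,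
    Nat.cast_one, Nat.cast_zero, Int.cast_natCast,
    apply_ite (algebraMap (ZMod 2) R), map_one, map_zero]
  refine Finset.sum_bij' (fun i _ => (i : ZMod N)) (fun t _ => t.val) ?_ ?_ ?_ ?_ ?_
  · simp
  · simp [ZMod.val_lt]
  · intro i hi
    exact ZMod.val_cast_of_lt (Finset.mem_range.mp hi)
  · simp
  · intro i hi
    rw [ZMod.val_cast_of_lt (Finset.mem_range.mp hi)]

theorem aeval_pow_two_pow {R : Type*} [CommRing R] [Algebra (ZMod 2) R] (p : (ZMod 2)[X]) (θ : R)
    (e : ℕ) : aeval (θ ^ 2 ^ e) p = aeval θ p ^ 2 ^ e := by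
  induction e with
  | zero => simp
  | succ e ih =>
    rw [pow_succ, pow_mul, ← expand_aeval, ZMod.expand_card, map_pow, ih, ← pow_mul]

theorem sum_pow_val_eq_geom_sum {R : Type*} [CommRing R] (N : ℕ) [NeZero N] (θ : R) :
    ∑ t : ZMod N, θ ^ t.val = ∑ i ∈ range N, θ ^ i := by
  refine Finset.sum_bij' (fun t _ => t.val) (fun i _ => (i : ZMod N)) ?_ ?_ ?_ ?_ ?_
  · simp [ZMod.val_lt]
  · simp
  · simp
  · intro i hi
    exact ZMod.val_cast_of_lt (Finset.mem_range.mp hi)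
  · simp

/-- A root of the sequence polynomial among the `N`-th roots of unity, in any commutative ring of
characteristic two, is trivial. -/
theorem eq_one_of_aeval_Spoly_eq_zero {R : Type*} [CommRing R] [Algebra (ZMod 2) R] {N : ℕ}
    [Fact N.Prime] {S : Set (ZMod N)} (h0 : (0 : ZMod N) ∉ S) {e : ℕ} (hN : (2 ^ e : ZMod N) ≠ 0)
    (hS : ∀ t ≠ 0, (2 ^ e * t ∈ S ↔ t ∉ S)) {θ : R} (hθ : θ ^ N = 1)
    (hroot : aeval θ (Spoly N (chiSeq N S)) = 0) : θ = 1 := by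
  classical
  have hpow (t : ZMod N) : θ ^ (2 ^ e * t).val = (θ ^ 2 ^ e) ^ t.val := by
    rw [← pow_mul, pow_eq_pow_mod (2 ^ e * t.val) hθ]
    congr 1
    rw [← ZMod.val_natCast]
    simp
  have hreindex (F : ZMod N → R) : ∑ t, F (2 ^ e * t) = ∑ t, F t :=
    Equiv.sum_comp (Equiv.mulLeft₀ (2 ^ e : ZMod N) hN) F
  have hrootpow : aeval (θ ^ 2 ^ e) (Spoly N (chiSeq N S)) = 0 := by
    rw [aeval_pow_two_pow, hroot, zero_pow (by positivity)]
  have hsum : ∑ t : ZMod N, θ ^ t.val = 1 := by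
    have hpoint (t : ZMod N) : θ ^ (2 ^ e * t).val =
        (if 2 ^ e * t ∈ S then 1 else 0) * θ ^ (2 ^ e * t).val +
          (if t ∈ S then 1 else 0) * (θ ^ 2 ^ e) ^ t.val + if t = 0 then 1 else 0 := by
      rw [← hpow]
      by_cases ht : t = 0
      · simp [ht, h0]
      · by_cases hmem : t ∈ S <;> simp [hS t ht, ht, hmem]
    rw [← hreindex, Finset.sum_congr rfl fun t _ => hpoint t, Finset.sum_add_distrib,
      Finset.sum_add_distrib, hreindex fun t => (if t ∈ S then 1 else 0) * θ ^ t.val,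
      ← aeval_Spoly_chiSeq, ← aeval_Spoly_chiSeq, hroot, hrootpow]
    simp
  have hgeom := geom_sum_mul θ N
  rw [← sum_pow_val_eq_geom_sum, hsum, hθ, one_mul, sub_self] at hgeom
  exact sub_eq_zero.mp hgeom

/-- The union of a set with a disjoint dilate of it has even size. -/
theorem aeval_one_Spoly_union {N : ℕ} [Fact N.Prime] {A B : Set (ZMod N)} (hAB : Disjoint A B)
    {b : ZMod N} (hb : b ≠ 0) (h : ∀ t, b * t ∈ B ↔ t ∈ A) :
    aeval (1 : ZMod 2) (Spoly N (chiSeq N (A ∪ B))) = 0 := by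
  classical
  have hpoint (t : ZMod N) : (if t ∈ A ∪ B then 1 else 0 : ZMod 2) =
      (if t ∈ A then 1 else 0) + if t ∈ B then 1 else 0 := by
    have : t ∈ A → t ∉ B := fun hA => Set.disjoint_left.mp hAB hA
    by_cases hA : t ∈ A <;> by_cases hB : t ∈ B <;> simp_all
  have hreindex : ∑ t, (if t ∈ B then 1 else 0 : ZMod 2) = ∑ t, if t ∈ A then 1 else 0 := by
    rw [← Equiv.sum_comp (Equiv.mulLeft₀ b hb)]
    simp [h]
  rw [aeval_Spoly_chiSeq]
  simp only [one_pow, mul_one]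
  calc
    _ = ∑ t, ((if t ∈ A then 1 else 0) + if t ∈ B then 1 else 0 : ZMod 2) :=
      Finset.sum_congr rfl fun t _ => by convert hpoint t
    _ = 0 := by rw [Finset.sum_add_distrib, hreindex, CharTwo.add_self_eq_zero]

/-- Over the field with two elements, mutual divisibility is equality. -/
theorem eq_of_dvd_dvd_zmod_two {p q : (ZMod 2)[X]} (hpq : p ∣ q) (hqp : q ∣ p) : p = q := by
  obtain ⟨u, rfl⟩ := associated_of_dvd_dvd hpq hqp
  obtain ⟨c, hc, hu⟩ := isUnit_iff.mp u.isUnit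
  have hc1 : c = 1 := by
    have hc0 := hc.ne_zero
    clear hu hc
    revert c
    decide
  rw [← hu, hc1, map_one, mul_one]

/-- minimal polynomial and linear complexity of `v` when `2 ∉ D_0`. -/
theorem stmt12 (N f : ℕ) (hprime : N.Prime) (hNf : N = 4 * f + 1) (hN5 : 5 ≤ N)
    (β : ZMod N) (hβ : orderOf β = N - 1)
    (h2 : (2 : ZMod N) ∉ Dclass N f β 0)
    (v : ℤ → ℕ)
    (hv : v = chiSeq N (Dclass N f β 1 ∪ Dclass N f β 2)) :
    EuclideanDomain.gcd (Spoly N v) (X ^ N - 1) = X - 1 ∧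
    (X ^ N - 1) / EuclideanDomain.gcd (Spoly N v) (X ^ N - 1) = (X ^ N - 1) / (X - 1) ∧
    N - (EuclideanDomain.gcd (Spoly N v) (X ^ N - 1)).natDegree = N - 1 := by
  have : Fact N.Prime := ⟨hprime⟩
  have hf : 0 < f := by omega
  have hmem {j : ℕ} (hj : j < 4) (n : ℕ) := pow_mem_Dclass_iff hNf hf hβ hj n
  have hβ0 : β ≠ 0 := by
    rintro rfl
    have := (isPrimitiveRoot_of_orderOf hβ).ne_zero (by omega)
    exact this rfl
  have hz {j : ℕ} : (0 : ZMod N) ∉ Dclass N f β j := fun h => ne_zero_of_mem_Dclass hβ0 h rfl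
  have htwo : (2 : ZMod N) ≠ 0 := by
    intro h
    have := Nat.le_of_dvd two_pos ((ZMod.natCast_eq_zero_iff 2 N).mp (mod_cast h))
    omega
  obtain ⟨m, hm⟩ := exists_pow_eq_of_ne_zero hβ htwo
  have hm4 : m % 4 ≠ 0 := by rwa [← hm, hmem (by norm_num)] at h2
  obtain ⟨e, he⟩ : ∃ e, m * e % 4 = 2 := by
    rcases (by omega : m % 4 = 2 ∨ m * 2 % 4 = 2) with h | h
    · exact ⟨1, by rwa [mul_one]⟩
    · exact ⟨2, h⟩
  have hcompl : ∀ t ≠ 0, (2 ^ e * t ∈ Dclass N f β 1 ∪ Dclass N f β 2 ↔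
      t ∉ Dclass N f β 1 ∪ Dclass N f β 2) := by
    intro t ht
    obtain ⟨n, rfl⟩ := exists_pow_eq_of_ne_zero hβ ht
    rw [← hm, ← pow_mul, ← pow_add]
    simp only [Set.mem_union, hmem (by norm_num : 1 < 4), hmem (by norm_num : 2 < 4)]
    omega
  have hdisj : Disjoint (Dclass N f β 1) (Dclass N f β 2) := by
    rw [Set.disjoint_left]
    rintro t ⟨k, -, rfl⟩ h
    rw [hmem (by norm_num)] at h
    omega
  have hshift (t : ZMod N) : β * t ∈ Dclass N f β 2 ↔ t ∈ Dclass N f β 1 := by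
    by_cases ht : t = 0
    · simp [ht, hz]
    · obtain ⟨n, rfl⟩ := exists_pow_eq_of_ne_zero hβ ht
      rw [← pow_succ', hmem (by norm_num), hmem (by norm_num)]
      omega
  have hgcd : EuclideanDomain.gcd (Spoly N v) (X ^ N - 1) = X - 1 := by
    apply eq_of_dvd_dvd_zmod_two
    · set g := EuclideanDomain.gcd (Spoly N v) (X ^ N - 1)
      have hroot : aeval (AdjoinRoot.root g) (Spoly N v) = 0 := by
        rw [AdjoinRoot.aeval_eq, AdjoinRoot.mk_eq_zero]
        exact EuclideanDomain.gcd_dvd_left _ _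
      have hpow : AdjoinRoot.root g ^ N = 1 := by
        have := AdjoinRoot.mk_eq_zero.mpr
          (EuclideanDomain.gcd_dvd_right (Spoly N v) (X ^ N - 1))
        simpa [sub_eq_zero] using this
      rw [hv] at hroot
      have hone := eq_one_of_aeval_Spoly_eq_zero (by simp [hz]) (pow_ne_zero e htwo) hcompl
        hpow hroot
      rw [← AdjoinRoot.mk_eq_zero]
      simp [hone]
    · refine EuclideanDomain.dvd_gcd ?_ (sub_one_dvd_pow_sub_one X N)
      rw [← C_1, dvd_iff_isRoot, IsRoot, ← coe_aeval_eq_eval, hv]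
      exact aeval_one_Spoly_union hdisj hβ0 hshift
  refine ⟨hgcd, by rw [hgcd], ?_⟩
  rw [hgcd, ← C_1, natDegree_X_sub_C]
end
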